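/- Let n > 1. Then in ℚ[x_1, …, x_n] one has f_{n−1,1} = Σ_{k=1}^{n−1} (−1)^{k−1} 𝔖_{w_k^{(n,1)}}, where 𝔖_{w_k^{(n,1)}} is the Schubert polynomial of the permutation w_k^{(n,1)} ∈ S_n. -/

import Mathlib

open MvPolynomial Finset

/-- The product of simple transpositions `s_a s_{a-1} ⋯ s_b` (descending indices),
where `s_r` interchanges `r` and `r+1`; the empty product (when `a < b`) is the identity. -/
def sdesc (a b : ℕ) : Equiv.Perm ℕ :=
  (((List.range' b (a + 1 - b)).reverse).map (fun r => Equiv.swap r (r + 1))).prod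

/-- The product of simple transpositions `s_a s_{a+1} ⋯ s_b` (ascending indices);
the empty product (when `b < a`) is the identity. -/
def sasc (a b : ℕ) : Equiv.Perm ℕ :=
  ((List.range' a (b + 1 - a)).map (fun r => Equiv.swap r (r + 1))).prod

/-- The permutation `w_k^{(i,j)} = (s_{i-k} s_{i-k-1} ⋯ s_j)(s_{i-k+1} s_{i-k+2} ⋯ s_{i-1})`,
regarded as a permutation of `ℕ` (supported on `{1, …, n}`). -/
def wkij (i j k : ℕ) : Equiv.Perm ℕ := sdesc (i - k) j * sasc (i - k + 1) (i - 1)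

/-- The longest element `w_0 = [n, n-1, …, 1]` of `S_n`, as a permutation of `ℕ`. -/
def revPerm (n : ℕ) : Equiv.Perm ℕ :=
  Function.Involutive.toPerm (fun x => if 1 ≤ x ∧ x ≤ n then n + 1 - x else x)
    (fun x => by simp only; split_ifs <;> omega)

/-- The polynomial `f_{i,j} = Σ_{k=1}^{j} (Π_{ℓ=j+1}^{i} (x_k - x_ℓ)) x_k` in `ℚ[x_1, …]`. -/
noncomputable def fpoly (i j : ℕ) : MvPolynomial ℕ ℚ :=
  ∑ k ∈ Finset.Icc 1 j, (∏ l ∈ Finset.Icc (j + 1) i, (X k - X l)) * X k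

/-- Some permutation with one-line notation `g` is sent by `S` to `P`. -/
def HasValue (S : Equiv.Perm ℕ → MvPolynomial ℕ ℚ) (g : ℕ → ℕ) (P : MvPolynomial ℕ ℚ) : Prop :=
  ∃ w : Equiv.Perm ℕ, (∀ x, w x = g x) ∧ S w = P

/-- The divided-difference recursion satisfied by the Schubert polynomials of `S_n`. -/
def SchubertRec (n : ℕ) (S : Equiv.Perm ℕ → MvPolynomial ℕ ℚ) : Prop :=
  ∀ w : Equiv.Perm ℕ, (∀ x, x ∉ Finset.Icc 1 n → w x = x) →
    ∀ r, 1 ≤ r → r < n → w (r + 1) < w r →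
      S w - rename (⇑(Equiv.swap r (r + 1))) (S w)
        = (X r - X (r + 1)) * S (w * Equiv.swap r (r + 1))

theorem HasValue.eq {S : Equiv.Perm ℕ → MvPolynomial ℕ ℚ} {g : ℕ → ℕ} {P : MvPolynomial ℕ ℚ}
    (h : HasValue S g P) {w : Equiv.Perm ℕ} (hw : ∀ x, w x = g x) : S w = P := by
  obtain ⟨v, hv, rfl⟩ := h
  congr 1
  ext x
  rw [hw, hv]

theorem HasValue.congr {S : Equiv.Perm ℕ → MvPolynomial ℕ ℚ} {g g' : ℕ → ℕ}
    {P P' : MvPolynomial ℕ ℚ} (h : HasValue S g P) (hg : ∀ x, g x = g' x) (hP : P = P') :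
    HasValue S g' P' := by
  obtain rfl : g = g' := funext hg
  exact hP ▸ h

theorem HasValue.step {n : ℕ} {S : Equiv.Perm ℕ → MvPolynomial ℕ ℚ} (hS : SchubertRec n S)
    {g g' : ℕ → ℕ} {P Q : MvPolynomial ℕ ℚ} (h : HasValue S g P)
    (hg : ∀ x, x ∉ Finset.Icc 1 n → g x = x) {r : ℕ} (h1 : 1 ≤ r) (hr : r < n)
    (hlt : g (r + 1) < g r)
    (hPQ : P - rename (⇑(Equiv.swap r (r + 1))) P = (X r - X (r + 1)) * Q)
    (hg' : ∀ x, g (if x = r then r + 1 else if x = r + 1 then r else x) = g' x) :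
    HasValue S g' Q := by
  obtain ⟨w, hw, rfl⟩ := h
  refine ⟨w * Equiv.swap r (r + 1), fun x => ?_, ?_⟩
  · rw [Equiv.Perm.mul_apply, hw, Equiv.swap_apply_def, hg']
  · have h2 := hS w (fun x hx => by rw [hw, hg x hx]) r h1 hr (by rw [hw, hw]; exact hlt)
    rw [hPQ] at h2
    refine (mul_left_cancel₀ (sub_ne_zero.2 fun h3 => ?_) h2).symm
    have := X_injective h3
    omega

theorem swap_succ_mem_Icc {a b r x : ℕ} (ha : a ≤ r) (hb : r + 1 ≤ b) :
    Equiv.swap r (r + 1) x ∈ Finset.Icc a b ↔ x ∈ Finset.Icc a b := by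
  rw [Equiv.swap_apply_def]
  simp only [Finset.mem_Icc]
  split_ifs <;> omega

theorem rename_prod_pow_eq_self (σ : Equiv.Perm ℕ) (A : Finset ℕ) (e : ℕ → ℕ)
    (hA : ∀ x, σ x ∈ A ↔ x ∈ A) (he : ∀ x ∈ A, e (σ x) = e x) :
    rename (⇑σ) (∏ x ∈ A, (X x : MvPolynomial ℕ ℚ) ^ e x) = ∏ x ∈ A, X x ^ e x := by
  rw [map_prod]
  refine Finset.prod_bijective σ σ.bijective (fun x => (hA x).symm) fun x hx => ?_
  rw [map_pow, rename_X, he x hx]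

/-- Moving the largest entry of a decreasing block to the end of that block. -/
theorem HasValue.sweep {n : ℕ} {S : Equiv.Perm ℕ → MvPolynomial ℕ ℚ} (hS : SchubertRec n S)
    {g : ℕ → ℕ} {Q : MvPolynomial ℕ ℚ} {a m : ℕ} (ham : a + m + 1 ≤ n)
    (hg : ∀ x, x ∉ Finset.Icc 1 n → g x = x)
    (hdec : ∀ x, a + 1 < x → x ≤ a + m + 1 → g x < g (a + 1))
    (hQ : ∀ r, a < r → r < a + m + 1 → rename (⇑(Equiv.swap r (r + 1))) Q = Q)
    (h : HasValue S g (Q * ∏ x ∈ Finset.Icc (a + 1) (a + m + 1), X x ^ (a + m + 1 - x)))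
    (i : ℕ) (hi : i ≤ m) :
    HasValue S
      (fun x => if a < x ∧ x ≤ a + i then g (x + 1) else if x = a + i + 1 then g (a + 1) else g x)
      (Q * ∏ x ∈ Finset.Icc (a + 1) (a + m + 1),
        X x ^ (if x ≤ a + i then a + m - x else a + m + 1 - x)) := by
  induction i with
  | zero =>
    refine h.congr (fun x => ?_) ?_
    · split_ifs with h1 h2
      · omega
      · rw [h2, Nat.add_zero]
      · rfl
    · congr 1
      refine Finset.prod_congr rfl fun x hx => ?_
      rw [Finset.mem_Icc] at hx
      rw [if_neg (by omega)]
  | succ i ih =>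
    refine (ih (by omega)).step hS (r := a + i + 1) ?_ (by omega) (by omega) ?_ ?_ ?_
    · intro x hx
      have h1 := hg x hx
      rw [Finset.mem_Icc] at hx
      rw [if_neg (by omega), if_neg (by omega), h1]
    · rw [if_neg (by omega), if_neg (by omega), if_neg (by omega), if_pos rfl]
      exact hdec _ (by omega) (by omega)
    · have hfac : ∏ x ∈ Finset.Icc (a + 1) (a + m + 1),
          (X x : MvPolynomial ℕ ℚ) ^ (if x ≤ a + i then a + m - x else a + m + 1 - x)
          = X (a + i + 1) * ∏ x ∈ Finset.Icc (a + 1) (a + m + 1),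
              X x ^ (if x ≤ a + (i + 1) then a + m - x else a + m + 1 - x) := by
        have hmem : a + i + 1 ∈ Finset.Icc (a + 1) (a + m + 1) := by
          rw [Finset.mem_Icc]; omega
        rw [← Finset.mul_prod_erase _ _ hmem, ← Finset.mul_prod_erase _ _ hmem, ← mul_assoc,
          ← pow_succ', if_neg (by omega), if_pos (by omega)]
        congr 1
        · congr 1; omega
        · refine Finset.prod_congr rfl fun x hx => ?_
          rw [Finset.mem_erase, Finset.mem_Icc] at hx
          congr 1
          split_ifs <;> omega
      have hsymm := rename_prod_pow_eq_self (Equiv.swap (a + i + 1) (a + i + 1 + 1))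
        (Finset.Icc (a + 1) (a + m + 1))
        (fun x => if x ≤ a + (i + 1) then a + m - x else a + m + 1 - x)
        (fun x => swap_succ_mem_Icc (by omega) (by omega)) (fun x _ => by
          rw [Equiv.swap_apply_def]
          split_ifs <;> omega)
      rw [hfac, map_mul, map_mul, hsymm, hQ _ (by omega) (by omega), rename_X,
        Equiv.swap_apply_left]
      ring
    · intro x
      split_ifs <;> first | omega | (congr 1; omega)

/-- Reversing a decreasing block removes a staircase factor. -/
theorem HasValue.reverse_block {n : ℕ} {S : Equiv.Perm ℕ → MvPolynomial ℕ ℚ}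
    (hS : SchubertRec n S) {Q : MvPolynomial ℕ ℚ} {a : ℕ} (m : ℕ) {g : ℕ → ℕ} (ham : a + m ≤ n)
    (hg : ∀ x, x ∉ Finset.Icc 1 n → g x = x)
    (hdec : ∀ x y, a < x → x < y → y ≤ a + m → g y < g x)
    (hQ : ∀ r, a < r → r < a + m → rename (⇑(Equiv.swap r (r + 1))) Q = Q)
    (h : HasValue S g (Q * ∏ x ∈ Finset.Icc (a + 1) (a + m), X x ^ (a + m - x))) :
    HasValue S (fun x => if a < x ∧ x ≤ a + m then g (2 * a + m + 1 - x) else g x) Q := by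
  induction m generalizing g with
  | zero =>
    refine h.congr (fun x => ?_) ?_
    · rw [if_neg (by omega)]
    · simp
  | succ m ih =>
    have h1 := h.sweep hS (m := m) (by omega) hg
      (fun x hx hx' => hdec _ _ (by omega) hx (by omega))
      (fun r h1 h2 => hQ r h1 (by omega)) m le_rfl
    refine (ih (by omega) ?_ ?_ (fun r h1 h2 => hQ r h1 (by omega))
      (h1.congr (fun _ => rfl) ?_)).congr ?_ rfl
    · intro x hx
      have h1 := hg x hx
      rw [Finset.mem_Icc] at hx
      rw [if_neg (by omega), if_neg (by omega), h1]
    · intro x y hx hxy hy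
      rw [if_pos (by omega), if_pos (by omega)]
      exact hdec _ _ (by omega) (by omega) (by omega)
    · congr 1
      rw [Finset.prod_Icc_succ_top (by omega), if_neg (by omega), Nat.sub_self, pow_zero, mul_one]
      refine Finset.prod_congr rfl fun x hx => ?_
      rw [Finset.mem_Icc] at hx
      rw [if_pos hx.2]
    · intro x
      split_ifs <;> first | omega | (congr 1; omega)

/-- The generating function `∏ (1 + x_l T)` of elementary symmetric polynomials. -/
noncomputable def elemSeries (A : Finset ℕ) : PowerSeries (MvPolynomial ℕ ℚ) :=
  ∏ l ∈ A, (1 + PowerSeries.C (X l) * PowerSeries.X)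

/-- The inverse `∏ (1 + x_l T)⁻¹` of `elemSeries`, generating signed complete symmetric
polynomials. -/
noncomputable def complSeries (A : Finset ℕ) : PowerSeries (MvPolynomial ℕ ℚ) :=
  ∏ l ∈ A, PowerSeries.mk fun i => (-X l) ^ i

theorem one_add_mul_geom (z : MvPolynomial ℕ ℚ) :
    (1 + PowerSeries.C z * PowerSeries.X) * (PowerSeries.mk fun i => (-z) ^ i) = 1 := by
  ext1 d
  rw [add_mul, one_mul, mul_assoc, map_add, PowerSeries.coeff_C_mul]
  cases d with
  | zero => simp
  | succ d =>
    rw [PowerSeries.coeff_succ_X_mul, PowerSeries.coeff_mk, PowerSeries.coeff_mk,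
      PowerSeries.coeff_one, if_neg (by omega)]
    ring

theorem elemSeries_mul_complSeries (A : Finset ℕ) : elemSeries A * complSeries A = 1 := by
  rw [elemSeries, complSeries, ← Finset.prod_mul_distrib]
  exact Finset.prod_eq_one fun l _ => one_add_mul_geom _

theorem elemSeries_union {A B : Finset ℕ} (h : Disjoint A B) :
    elemSeries (A ∪ B) = elemSeries A * elemSeries B :=
  Finset.prod_union h

theorem coeff_zero_elemSeries (A : Finset ℕ) : PowerSeries.coeff 0 (elemSeries A) = 1 := by
  rw [elemSeries, PowerSeries.coeff_zero_eq_constantCoeff_apply, map_prod]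
  exact Finset.prod_eq_one fun l _ => by simp

theorem coeff_elemSeries_of_card_lt (A : Finset ℕ) {d : ℕ} (h : A.card < d) :
    PowerSeries.coeff d (elemSeries A) = 0 := by
  induction A using Finset.induction_on generalizing d with
  | empty =>
    rw [elemSeries, Finset.prod_empty, PowerSeries.coeff_one, if_neg]
    rintro rfl
    simp at h
  | insert a A ha ih =>
    rw [Finset.card_insert_of_notMem ha] at h
    obtain ⟨d, rfl⟩ : ∃ e, d = e + 1 := ⟨d - 1, by omega⟩
    have h1 : elemSeries (insert a A)
        = elemSeries A + PowerSeries.C (X a) * (PowerSeries.X * elemSeries A) := by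
      rw [elemSeries, Finset.prod_insert ha, ← elemSeries]
      ring
    rw [h1, map_add, PowerSeries.coeff_C_mul, PowerSeries.coeff_succ_X_mul, ih (by omega),
      ih (by omega), mul_zero, add_zero]

theorem rename_coeff_elemSeries (σ : Equiv.Perm ℕ) {A : Finset ℕ} (hA : ∀ x, σ x ∈ A ↔ x ∈ A)
    (d : ℕ) : rename (⇑σ) (PowerSeries.coeff d (elemSeries A))
      = PowerSeries.coeff d (elemSeries A) := by
  have h := PowerSeries.coeff_map (rename (R := ℚ) (⇑σ)).toRingHom d (elemSeries A)
  refine h.symm.trans (congrArg _ ?_)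
  rw [elemSeries, map_prod]
  refine Finset.prod_bijective σ σ.bijective (fun x => (hA x).symm) fun x hx => ?_
  simp

theorem rename_coeff_complSeries (σ : Equiv.Perm ℕ) {A : Finset ℕ} (hA : ∀ x, σ x ∈ A ↔ x ∈ A)
    (d : ℕ) : rename (⇑σ) (PowerSeries.coeff d (complSeries A))
      = PowerSeries.coeff d (complSeries A) := by
  have h := PowerSeries.coeff_map (rename (R := ℚ) (⇑σ)).toRingHom d (complSeries A)
  refine h.symm.trans (congrArg _ ?_)
  rw [complSeries, map_prod]
  refine Finset.prod_bijective σ σ.bijective (fun x => (hA x).symm) fun x hx => ?_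
  ext1 i
  simp

theorem coeff_succ_complSeries_Icc {a b : ℕ} (hab : a ≤ b + 1) (d : ℕ) :
    PowerSeries.coeff (d + 1) (complSeries (Finset.Icc a b))
      = PowerSeries.coeff (d + 1) (complSeries (Finset.Icc a (b + 1)))
        + X (b + 1) * PowerSeries.coeff d (complSeries (Finset.Icc a (b + 1))) := by
  have h : complSeries (Finset.Icc a b) = complSeries (Finset.Icc a (b + 1))
      + PowerSeries.C (X (b + 1)) * (PowerSeries.X * complSeries (Finset.Icc a (b + 1))) := by
    have h1 : complSeries (Finset.Icc a (b + 1)) = complSeries (Finset.Icc a b)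
        * PowerSeries.mk fun i => (-X (b + 1)) ^ i := Finset.prod_Icc_succ_top hab _
    rw [h1]
    linear_combination (-complSeries (Finset.Icc a b)) * one_add_mul_geom (X (b + 1))
  rw [h, map_add, PowerSeries.coeff_C_mul, PowerSeries.coeff_succ_X_mul]

theorem complSeries_Icc_sub_rename {a b : ℕ} (hab : a ≤ b) (d : ℕ) :
    PowerSeries.coeff (d + 1) (complSeries (Finset.Icc a b))
      - rename (⇑(Equiv.swap b (b + 1)))
          (PowerSeries.coeff (d + 1) (complSeries (Finset.Icc a b)))
      = -(X b - X (b + 1)) * PowerSeries.coeff d (complSeries (Finset.Icc a (b + 1))) := by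
  have hσ := rename_coeff_complSeries (Equiv.swap b (b + 1)) (A := Finset.Icc a (b + 1))
    (fun x => swap_succ_mem_Icc hab le_rfl)
  rw [coeff_succ_complSeries_Icc (by omega), map_add, map_mul, hσ, hσ, rename_X,
    Equiv.swap_apply_right]
  ring

/-- The polynomial obtained from `x_a ^ (c + b - a) * e_d(x_{a+1}, …, x_N)` by applying the divided
differences `∂_a, …, ∂_{b-1}`, in closed form. -/
noncomputable def mixedPoly (N d c a b : ℕ) : MvPolynomial ℕ ℚ :=
  (-1) ^ c * ∑ i ∈ Finset.range (d + 1), PowerSeries.coeff (c + i) (complSeries (Finset.Icc a b))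
    * PowerSeries.coeff (d - i) (elemSeries (Finset.Icc a N))

theorem mixedPoly_sub_rename {N d c a b : ℕ} (hab : a ≤ b) (hb : b + 1 ≤ N) :
    mixedPoly N d (c + 1) a b - rename (⇑(Equiv.swap b (b + 1))) (mixedPoly N d (c + 1) a b)
      = (X b - X (b + 1)) * mixedPoly N d c a (b + 1) := by
  have hσ := rename_coeff_elemSeries (Equiv.swap b (b + 1)) (A := Finset.Icc a N)
    (fun x => swap_succ_mem_Icc hab hb)
  simp only [mixedPoly, map_mul, map_pow, map_neg, map_one, map_sum, hσ]
  have hsum : ∀ i ∈ Finset.range (d + 1),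
      PowerSeries.coeff (c + 1 + i) (complSeries (Finset.Icc a b))
          * PowerSeries.coeff (d - i) (elemSeries (Finset.Icc a N))
        - rename (⇑(Equiv.swap b (b + 1)))
            (PowerSeries.coeff (c + 1 + i) (complSeries (Finset.Icc a b)))
          * PowerSeries.coeff (d - i) (elemSeries (Finset.Icc a N))
      = -(X b - X (b + 1)) * (PowerSeries.coeff (c + i) (complSeries (Finset.Icc a (b + 1)))
          * PowerSeries.coeff (d - i) (elemSeries (Finset.Icc a N))) := fun i _ => by
    rw [← sub_mul, add_right_comm, complSeries_Icc_sub_rename hab, mul_assoc]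
  rw [← mul_sub, ← Finset.sum_sub_distrib, Finset.sum_congr rfl hsum, ← Finset.mul_sum]
  ring

theorem mixedPoly_self {N d c a : ℕ} (ha : a ≤ N) :
    mixedPoly N d c a a
      = X a ^ c * PowerSeries.coeff d (elemSeries (Finset.Icc (a + 1) N)) := by
  have h : elemSeries (Finset.Icc (a + 1) N)
      = (PowerSeries.mk fun i => (-X a) ^ i) * elemSeries (Finset.Icc a N) := by
    have h1 : elemSeries (Finset.Icc a N)
        = (1 + PowerSeries.C (X a) * PowerSeries.X) * elemSeries (Finset.Icc (a + 1) N) := by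
      rw [← Finset.insert_Icc_add_one_left_eq_Icc ha, elemSeries,
        Finset.prod_insert (by simp), ← elemSeries]
    rw [h1]
    linear_combination (-elemSeries (Finset.Icc (a + 1) N)) * one_add_mul_geom (X a)
  rw [mixedPoly, h, PowerSeries.coeff_mul, Finset.Nat.sum_antidiagonal_eq_sum_range_succ_mk,
    Finset.mul_sum, Finset.mul_sum]
  refine Finset.sum_congr rfl fun i _ => ?_
  simp only [complSeries, Finset.Icc_self, Finset.prod_singleton, PowerSeries.coeff_mk]
  rw [pow_add, neg_pow (X a : MvPolynomial ℕ ℚ) c]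
  have h2 : ((-1 : MvPolynomial ℕ ℚ) ^ c) * (-1) ^ c = 1 := by
    rw [← mul_pow]; simp
  linear_combination (X a ^ c * (-X a) ^ i
    * PowerSeries.coeff (d - i) (elemSeries (Finset.Icc a N))) * h2

theorem mixedPoly_one {N d a b : ℕ} (hab : a ≤ b + 1) (hN : b + d = N) :
    mixedPoly N d 1 a b = PowerSeries.coeff (d + 1) (elemSeries (Finset.Icc a N)) := by
  have h : complSeries (Finset.Icc a b) * elemSeries (Finset.Icc a N)
      = elemSeries (Finset.Icc (b + 1) N) := by
    have h1 : Finset.Icc a N = Finset.Icc a b ∪ Finset.Icc (b + 1) N := by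
      ext x
      simp only [Finset.mem_union, Finset.mem_Icc]
      omega
    have h2 : Disjoint (Finset.Icc a b) (Finset.Icc (b + 1) N) := by
      rw [Finset.disjoint_left]
      intro x
      simp only [Finset.mem_Icc]
      omega
    rw [h1, elemSeries_union h2, ← mul_assoc, mul_comm (complSeries _),
      elemSeries_mul_complSeries, one_mul]
  have h3 := congrArg (PowerSeries.coeff (d + 1)) h
  rw [coeff_elemSeries_of_card_lt _ (by rw [Nat.card_Icc]; omega), PowerSeries.coeff_mul,
    Finset.Nat.sum_antidiagonal_eq_sum_range_succ_mk, Finset.sum_range_succ'] at h3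
  have h4 : PowerSeries.coeff 0 (complSeries (Finset.Icc a b)) = 1 := by
    rw [complSeries, PowerSeries.coeff_zero_eq_constantCoeff_apply, map_prod]
    refine Finset.prod_eq_one fun l _ => ?_
    rw [← PowerSeries.coeff_zero_eq_constantCoeff_apply, PowerSeries.coeff_mk, pow_zero]
  simp only [h4, one_mul, Nat.sub_zero, Nat.add_sub_add_right] at h3
  rw [mixedPoly, pow_one, neg_one_mul, neg_eq_iff_add_eq_zero, ← h3]
  simp only [add_comm 1]

theorem sum_coeff_elemSeries_eq_prod_sub (z : MvPolynomial ℕ ℚ) (A : Finset ℕ) :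
    ∑ i ∈ Finset.range (A.card + 1),
      (-1) ^ i * (z ^ (A.card - i) * PowerSeries.coeff i (elemSeries A)) = ∏ l ∈ A, (z - X l) := by
  induction A using Finset.induction_on with
  | empty => simp [elemSeries]
  | insert a A ha ih =>
    have h1 : elemSeries (insert a A)
        = elemSeries A + PowerSeries.C (X a) * (PowerSeries.X * elemSeries A) := by
      rw [elemSeries, Finset.prod_insert ha, ← elemSeries]
      ring
    rw [Finset.prod_insert ha, Finset.card_insert_of_notMem ha, ← ih, sub_mul, h1]
    simp only [map_add, PowerSeries.coeff_C_mul, mul_add, Finset.sum_add_distrib]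
    rw [sub_eq_add_neg]
    congr 1
    · rw [Finset.sum_range_succ, coeff_elemSeries_of_card_lt A (Nat.lt_succ_self _), mul_zero,
        mul_zero, add_zero, Finset.mul_sum]
      refine Finset.sum_congr rfl fun i hi => ?_
      rw [Finset.mem_range] at hi
      rw [show A.card + 1 - i = A.card - i + 1 by omega]
      ring
    · rw [Finset.sum_range_succ', PowerSeries.coeff_zero_X_mul, mul_zero, mul_zero, mul_zero,
        add_zero, Finset.mul_sum, ← Finset.sum_neg_distrib]
      refine Finset.sum_congr rfl fun i _ => ?_
      rw [PowerSeries.coeff_succ_X_mul, Nat.add_sub_add_right]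
      ring

theorem prod_map_swap_range'_apply (a m x : ℕ) :
    ((List.range' a m).map (fun r => Equiv.swap r (r + 1))).prod x
      = if x = a + m then a else if a ≤ x ∧ x < a + m then x + 1 else x := by
  induction m generalizing a with
  | zero =>
    simp only [List.range'_zero, List.map_nil, List.prod_nil, Equiv.Perm.one_apply]
    split_ifs <;> omega
  | succ m ih =>
    rw [List.range'_succ, List.map_cons, List.prod_cons, Equiv.Perm.mul_apply, ih,
      Equiv.swap_apply_def]
    split_ifs <;> omega

theorem prod_map_swap_reverse_range'_apply (a m x : ℕ) :
    (((List.range' a m).reverse).map (fun r => Equiv.swap r (r + 1))).prod x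
      = if x = a then a + m else if a < x ∧ x ≤ a + m then x - 1 else x := by
  induction m generalizing a x with
  | zero =>
    simp only [List.range'_zero, List.reverse_nil, List.map_nil, List.prod_nil,
      Equiv.Perm.one_apply]
    split_ifs <;> omega
  | succ m ih =>
    rw [List.range'_succ, List.reverse_cons, List.map_append, List.prod_append,
      Equiv.Perm.mul_apply, ih, List.map_singleton, List.prod_singleton, Equiv.swap_apply_def]
    split_ifs <;> omega

theorem wkij_one_apply {n k : ℕ} (hk : 1 ≤ k) (hkn : k < n) (x : ℕ) :
    wkij n 1 k x = if x = 1 then n - k + 1 else if 1 < x ∧ x ≤ n - k then x - 1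
      else if n - k < x ∧ x < n then x + 1 else if x = n then n - k else x := by
  rw [wkij, Equiv.Perm.mul_apply, sasc, sdesc, prod_map_swap_range'_apply,
    prod_map_swap_reverse_range'_apply]
  split_ifs <;> omega

/-- One-line notation of the permutations joining `[n-k+1, …, n, 1, …, n-k]` to `w_k^{(n,1)}`:
the entry `n-k+j` is located in position `j+t`. -/
def pathFun (n k j t x : ℕ) : ℕ :=
  if 1 ≤ x ∧ x < j then n - k + x else if j ≤ x ∧ x < j + t then x - j + 1
  else if x = j + t then n - k + j else if j + t < x ∧ x < j + (n - k) then x - j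
  else if j + (n - k) ≤ x ∧ x < n then x + 1 else if x = n then n - k else x

theorem hasValue_dominant {n k : ℕ} {S : Equiv.Perm ℕ → MvPolynomial ℕ ℚ} (hS : SchubertRec n S)
    (hS0 : S (revPerm n) = ∏ r ∈ Finset.Icc 1 (n - 1), X r ^ (n - r)) (hk : 1 ≤ k) (hkn : k < n) :
    HasValue S (pathFun n k k 0) (∏ x ∈ Finset.Icc 1 k, X x ^ (n - k)) := by
  have h0 : HasValue S (fun x => if 1 ≤ x ∧ x ≤ n then n + 1 - x else x)
      ((∏ x ∈ Finset.Icc 1 k, X x ^ (n - x))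
        * ∏ x ∈ Finset.Icc (k + 1) (k + (n - k)), X x ^ (k + (n - k) - x)) := by
    refine ⟨revPerm n, fun x => rfl, hS0.trans ?_⟩
    obtain ⟨p, rfl⟩ : ∃ p, n = p + 1 := ⟨n - 1, by omega⟩
    rw [show k + (p + 1 - k) = p + 1 by omega, Finset.prod_Icc_succ_top (by omega), Nat.sub_self,
      pow_zero, mul_one, ← Finset.prod_union, Nat.add_sub_cancel]
    · refine Finset.prod_congr ?_ fun _ _ => rfl
      ext x
      simp only [Finset.mem_union, Finset.mem_Icc]
      omega
    · rw [Finset.disjoint_left]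
      intro x
      simp only [Finset.mem_Icc]
      omega
  have h1 := h0.reverse_block hS (n - k) (by omega)
    (fun x hx => by rw [Finset.mem_Icc] at hx; rw [if_neg hx])
    (fun x y hx hxy hy => by rw [if_pos (by omega), if_pos (by omega)]; omega)
    (fun r hr _ => rename_prod_pow_eq_self _ _ (fun x => n - x)
      (fun x => by
        rw [Equiv.swap_apply_def]; simp only [Finset.mem_Icc]; split_ifs <;> omega)
      (fun x hx => by
        rw [Finset.mem_Icc] at hx
        rw [Equiv.swap_apply_of_ne_of_ne (by omega) (by omega)]))
  have h2 := h1.congr (P' := (∏ x ∈ Finset.Icc 1 k, X x ^ (n - k))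
      * ∏ x ∈ Finset.Icc (0 + 1) (0 + k), X x ^ (0 + k - x)) (fun _ => rfl) (by
    rw [Nat.zero_add, Nat.zero_add, ← Finset.prod_mul_distrib]
    refine Finset.prod_congr rfl fun x hx => ?_
    rw [Finset.mem_Icc] at hx
    rw [← pow_add]
    congr 1
    omega)
  refine (h2.reverse_block hS k (by omega) ?_ ?_ ?_).congr ?_ rfl
  · intro x hx
    rw [Finset.mem_Icc] at hx
    rw [if_neg (by omega), if_neg (by omega)]
  · intro x y hx hxy hy
    split_ifs <;> omega
  · exact fun r hr hr' => rename_prod_pow_eq_self _ _ (fun _ => n - k)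
      (fun x => swap_succ_mem_Icc (by omega) (by omega)) (fun _ _ => rfl)
  · intro x
    simp only [pathFun]
    split_ifs <;> omega

theorem HasValue.path {n k j : ℕ} {S : Equiv.Perm ℕ → MvPolynomial ℕ ℚ} (hS : SchubertRec n S)
    (hkn : k < n) (hj : 1 ≤ j) (hjk : j ≤ k)
    (h : HasValue S (pathFun n k j 0) ((∏ x ∈ Finset.Icc 1 (j - 1), X x ^ (n - k))
      * mixedPoly (n - 1) (k - j) (n - k) j j)) (t : ℕ) (ht : t < n - k) :
    HasValue S (pathFun n k j t) ((∏ x ∈ Finset.Icc 1 (j - 1), X x ^ (n - k))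
      * mixedPoly (n - 1) (k - j) (n - k - t) j (j + t)) := by
  induction t with
  | zero => exact h
  | succ t ih =>
    refine (ih (by omega)).step hS (r := j + t) ?_ (by omega) (by omega) ?_ ?_ ?_
    · intro x hx
      rw [Finset.mem_Icc] at hx
      rw [pathFun]
      split_ifs <;> omega
    · rw [pathFun, pathFun]
      split_ifs <;> omega
    · have hM := rename_prod_pow_eq_self (Equiv.swap (j + t) (j + t + 1)) (Finset.Icc 1 (j - 1))
        (fun _ => n - k)
        (fun x => by
          rw [Equiv.swap_apply_def]; simp only [Finset.mem_Icc]; split_ifs <;> omega)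
        (fun _ _ => rfl)
      have h1 := mixedPoly_sub_rename (N := n - 1) (d := k - j) (c := n - k - (t + 1)) (a := j)
        (b := j + t) (by omega) (by omega)
      rw [show n - k - (t + 1) + 1 = n - k - t by omega] at h1
      rw [map_mul, hM, ← mul_sub, h1, mul_left_comm, add_assoc]
    · intro x
      rcases eq_or_ne x (j + t) with rfl | h1
      · rw [if_pos rfl, pathFun, pathFun, if_neg (by omega), if_neg (by omega),
          if_neg (by omega), if_pos (by omega), if_neg (by omega), if_pos (by omega)]
        omega
      rcases eq_or_ne x (j + t + 1) with rfl | h2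
      · rw [if_neg h1, if_pos rfl, pathFun, pathFun, if_neg (by omega), if_neg (by omega),
          if_pos rfl, if_neg (by omega), if_neg (by omega), if_pos (by omega)]
      · rw [if_neg h1, if_neg h2, pathFun, pathFun]
        refine if_congr Iff.rfl rfl (if_congr (by omega) rfl ?_)
        rw [if_neg h1, if_neg (c := x = j + (t + 1)) (by omega)]
        exact if_congr (by omega) rfl rfl

theorem hasValue_pathFun {n k : ℕ} {S : Equiv.Perm ℕ → MvPolynomial ℕ ℚ} (hS : SchubertRec n S)
    (hS0 : S (revPerm n) = ∏ r ∈ Finset.Icc 1 (n - 1), X r ^ (n - r)) (hkn : k < n)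
    (i : ℕ) (hi : i < k) :
    HasValue S (pathFun n k (k - i) 0) ((∏ x ∈ Finset.Icc 1 (k - i), X x ^ (n - k))
      * PowerSeries.coeff i (elemSeries (Finset.Icc (k - i + 1) (n - 1)))) := by
  induction i with
  | zero =>
    refine (hasValue_dominant hS hS0 (by omega) hkn).congr (fun _ => rfl) ?_
    rw [coeff_zero_elemSeries, mul_one, Nat.sub_zero]
  | succ i ih =>
    obtain ⟨j, hj⟩ : ∃ j, k - (i + 1) = j := ⟨_, rfl⟩
    have hj' : k - i = j + 1 := by omega
    have h1 := ih (by omega)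
    rw [hj'] at h1
    have h2 := HasValue.path hS hkn (j := j + 1) (by omega) (by omega) (h1.congr (fun _ => rfl)
      (by
        rw [mixedPoly_self (by omega), Finset.prod_Icc_succ_top (by omega), mul_assoc,
          Nat.add_sub_cancel, show k - (j + 1) = i by omega])) (n - k - 1) (by omega)
    rw [hj]
    refine h2.congr (fun x => ?_) ?_
    · rw [pathFun, pathFun]
      split_ifs <;> omega
    · rw [show n - k - (n - k - 1) = 1 by omega, mixedPoly_one (by omega) (by omega),
        show k - (j + 1) = i by omega, Nat.add_sub_cancel]

/-- The Schubert polynomial of `w_k^{(n,1)}` is `x_1^{n-k} e_{k-1}(x_2, …, x_{n-1})`. -/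
theorem schubert_wkij_one {n k : ℕ} {S : Equiv.Perm ℕ → MvPolynomial ℕ ℚ} (hS : SchubertRec n S)
    (hS0 : S (revPerm n) = ∏ r ∈ Finset.Icc 1 (n - 1), X r ^ (n - r)) (hk : 1 ≤ k) (hkn : k < n) :
    S (wkij n 1 k)
      = X 1 ^ (n - k) * PowerSeries.coeff (k - 1) (elemSeries (Finset.Icc 2 (n - 1))) := by
  have h := hasValue_pathFun hS hS0 hkn (k - 1) (by omega)
  rw [show k - (k - 1) = 1 by omega, Finset.Icc_self, Finset.prod_singleton] at h
  refine h.eq fun x => ?_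
  rw [wkij_one_apply hk hkn, pathFun]
  split_ifs <;> omega


/-- Proposition 3.2 of the paper.  For `n > 1`,
`f_{n-1,1} = Σ_{k=1}^{n-1} (-1)^{k-1} 𝔖_{w_k^{(n,1)}}` in `ℚ[x_1, …, x_n]`.
The Schubert polynomials are encoded as any family `S` satisfying their defining
properties (see the hypotheses `hS0` and `hSrec`). -/
theorem stmt1 (n : ℕ) (hn : 1 < n)
    (S : Equiv.Perm ℕ → MvPolynomial ℕ ℚ)
    (hS0 : S (revPerm n) = ∏ r ∈ Finset.Icc 1 (n - 1), X r ^ (n - r))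
    (hSrec : ∀ w : Equiv.Perm ℕ, (∀ x, x ∉ Finset.Icc 1 n → w x = x) →
      ∀ r, 1 ≤ r → r < n → w (r + 1) < w r →
        S w - rename (⇑(Equiv.swap r (r + 1))) (S w)
          = (X r - X (r + 1)) * S (w * Equiv.swap r (r + 1))) :
    fpoly (n - 1) 1
      = ∑ k ∈ Finset.Icc 1 (n - 1), (-1 : MvPolynomial ℕ ℚ) ^ (k - 1) * S (wkij n 1 k) := by
  have hcard : (Finset.Icc 2 (n - 1)).card = n - 2 := by rw [Nat.card_Icc]; omega
  have h := sum_coeff_elemSeries_eq_prod_sub (X 1) (Finset.Icc 2 (n - 1))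
  rw [hcard, show n - 2 + 1 = n - 1 by omega] at h
  rw [fpoly, Finset.Icc_self, Finset.sum_singleton, ← h, Finset.sum_mul,
    ← Finset.Ico_add_one_right_eq_Icc 1 (n - 1), Finset.sum_Ico_eq_sum_range, Nat.add_sub_cancel]
  refine Finset.sum_congr rfl fun i hi => ?_
  rw [Finset.mem_range] at hi
  rw [schubert_wkij_one hSrec hS0 (by omega) (by omega), Nat.add_sub_cancel_left,
    show n - (1 + i) = n - 2 - i + 1 by omega]
  ring
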